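/- Let a > 0 and n ≥ 2. Let μ_a be the probability measure on ℝ^{n-1} × ℝ^n given by the product of the Dirichlet(1,...,1) measure (density (n−1)! on the simplex Δ ⊂ ℝ^{n-1} with respect to Lebesgue measure) and the n-fold product of the Arcsin distribution on (−a, a). Then the pushforward of μ_a under the map ((r_1, ..., r_{n-1}), (x_1, ..., x_n)) ↦ r_1 x_1 + ⋯ + r_{n-1} x_{n-1} + (1 − r_1 − ⋯ − r_{n-1}) x_n is the power semicircle distribution on (−a, a) with parameter λ = (n−1)/2, i.e. the measure on ℝ with density f(x; λ, a) = (1/(√π · a^{2λ})) · (Γ(λ + 1)/Γ(λ + 1/2)) · (a² − x²)^{λ − 1/2} on (−a, a) with respect to Lebesgue measure. -/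

import Mathlib

open MeasureTheory

/-- The Arcsin distribution on `(-a, a)`: density `x ↦ 1/(π √(a² - x²))` on `(-a, a)`
(and `0` elsewhere) with respect to Lebesgue measure. -/
noncomputable def arcsinMeasureOn (a : ℝ) : Measure ℝ :=
  volume.withDensity fun x =>
    ENNReal.ofReal (Set.indicator (Set.Ioo (-a) a)
      (fun x => 1 / (Real.pi * Real.sqrt (a ^ 2 - x ^ 2))) x)

/-- The power semicircle distribution on `(-a, a)` with parameter `λ`: density
`(1/(√π a^{2λ})) (Γ(λ+1)/Γ(λ+1/2)) (a² - x²)^{λ-1/2}` on `(-a, a)` with respect to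
Lebesgue measure. -/
noncomputable def powerSemicircleOn (lam a : ℝ) : Measure ℝ :=
  volume.withDensity fun x =>
    ENNReal.ofReal (Set.indicator (Set.Ioo (-a) a)
      (fun x => (1 / (Real.sqrt Real.pi * a ^ (2 * lam))) *
        (Real.Gamma (lam + 1) / Real.Gamma (lam + 1 / 2)) *
        (a ^ 2 - x ^ 2) ^ (lam - 1 / 2)) x)

/-- The Dirichlet(1, ..., 1) distribution on the `m`-dimensional simplex: constant
density `m!` on `Δ` with respect to Lebesgue measure on `ℝ^m`. -/
noncomputable def dirichletOnes (m : ℕ) : Measure (Fin m → ℝ) :=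
  (m.factorial : ENNReal) • volume.restrict {p | (∀ j, 0 ≤ p j) ∧ ∑ j, p j ≤ 1}

open Set Filter Topology ProbabilityTheory
open scoped Polynomial ENNReal

section MomentDetermination

variable {μ ν : Measure ℝ} {b c : ℝ}

theorem integrable_of_ae_mem_Icc [IsFiniteMeasure μ] (hμ : ∀ᵐ x ∂μ, x ∈ Icc b c)
    {f : ℝ → ℝ} (hf : Continuous f) : Integrable f μ := by
  obtain ⟨C, hC⟩ := isCompact_Icc.exists_bound_of_continuousOn (s := Icc b c) hf.continuousOn
  exact .of_bound hf.aestronglyMeasurable C (hμ.mono hC)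

theorem integral_polynomial_eq_of_moments [IsFiniteMeasure μ] [IsFiniteMeasure ν]
    (hμ : ∀ᵐ x ∂μ, x ∈ Icc b c) (hν : ∀ᵐ x ∂ν, x ∈ Icc b c)
    (h : ∀ k : ℕ, ∫ x, x ^ k ∂μ = ∫ x, x ^ k ∂ν) (p : ℝ[X]) :
    ∫ x, p.eval x ∂μ = ∫ x, p.eval x ∂ν := by
  simp_rw [Polynomial.eval_eq_sum_range]
  rw [integral_finsetSum _ fun i _ => integrable_of_ae_mem_Icc hμ (by fun_prop),
    integral_finsetSum _ fun i _ => integrable_of_ae_mem_Icc hν (by fun_prop)]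
  simp_rw [integral_const_mul, h]

theorem dist_integral_le_of_approx [IsProbabilityMeasure μ] (hμ : ∀ᵐ x ∂μ, x ∈ Icc b c)
    {f g : ℝ → ℝ} (hf : Continuous f) (hg : Continuous g) {ε : ℝ}
    (h : ∀ x ∈ Icc b c, |g x - f x| < ε) : |∫ x, g x ∂μ - ∫ x, f x ∂μ| ≤ ε := by
  rw [← integral_sub (integrable_of_ae_mem_Icc hμ hg) (integrable_of_ae_mem_Icc hμ hf)]
  simpa using norm_integral_le_of_norm_le_const (μ := μ) (f := fun x => g x - f x)
    (hμ.mono fun x hx => (h x hx).le)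

/-- Compactly supported probability measures on `ℝ` are determined by their moments. -/
theorem measure_eq_of_moments [IsProbabilityMeasure μ] [IsProbabilityMeasure ν]
    (hμ : ∀ᵐ x ∂μ, x ∈ Icc b c) (hν : ∀ᵐ x ∂ν, x ∈ Icc b c)
    (h : ∀ k : ℕ, ∫ x, x ^ k ∂μ = ∫ x, x ^ k ∂ν) : μ = ν := by
  refine ext_of_forall_integral_eq_of_IsFiniteMeasure fun f => ?_
  refine eq_of_forall_dist_le fun ε hε => ?_
  obtain ⟨p, hp⟩ := exists_polynomial_near_of_continuousOn b c f f.continuous.continuousOn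
    (ε / 2) (by positivity)
  have h₁ := dist_integral_le_of_approx hμ f.continuous p.continuous hp
  have h₂ := dist_integral_le_of_approx hν f.continuous p.continuous hp
  have h₃ := integral_polynomial_eq_of_moments hμ hν h p
  rw [Real.dist_eq]
  rw [abs_le] at *
  constructor <;> linarith

end MomentDetermination

section BetaMoments

theorem betaPDFReal_nonneg {α β : ℝ} (hα : 0 < α) (hβ : 0 < β) (x : ℝ) :
    0 ≤ betaPDFReal α β x := by
  by_cases hx : 0 < x ∧ x < 1
  · exact (betaPDFReal_pos hx.1 hx.2 hα hβ).le
  · simp [betaPDFReal, hx]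

theorem integrable_betaPDFReal {α β : ℝ} (hα : 0 < α) (hβ : 0 < β) :
    Integrable (betaPDFReal α β) := by
  refine ⟨(measurable_betaPDFReal α β).aestronglyMeasurable, ?_⟩
  rw [hasFiniteIntegral_iff_ofReal (ae_of_all _ (betaPDFReal_nonneg hα hβ))]
  exact (lintegral_betaPDF_eq_one hα hβ).trans_lt ENNReal.one_lt_top

theorem integral_betaPDFReal {α β : ℝ} (hα : 0 < α) (hβ : 0 < β) :
    ∫ x, betaPDFReal α β x = 1 := by
  rw [integral_eq_lintegral_of_nonneg_ae (ae_of_all _ (betaPDFReal_nonneg hα hβ))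
    (measurable_betaPDFReal α β).aestronglyMeasurable]
  exact (congrArg ENNReal.toReal (lintegral_betaPDF_eq_one hα hβ)).trans ENNReal.toReal_one

theorem integral_betaMeasure {α β : ℝ} (hα : 0 < α) (hβ : 0 < β) (f : ℝ → ℝ) :
    ∫ x, f x ∂betaMeasure α β = ∫ x, betaPDFReal α β x * f x := by
  unfold betaMeasure betaPDF
  rw [integral_withDensity_eq_integral_toReal_smul (by fun_prop) (by simp)]
  simp_rw [ENNReal.toReal_ofReal (betaPDFReal_nonneg hα hβ _), smul_eq_mul]

/-- The mixed moments of the Beta distribution. -/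
theorem integral_betaMeasure_pow_mul_pow {α β : ℝ} (hα : 0 < α) (hβ : 0 < β) (i j : ℕ) :
    ∫ x, x ^ i * (1 - x) ^ j ∂betaMeasure α β = beta (α + i) (β + j) / beta α β := by
  rw [integral_betaMeasure hα hβ]
  have key : ∀ x, betaPDFReal α β x * (x ^ i * (1 - x) ^ j)
      = beta (α + i) (β + j) / beta α β * betaPDFReal (α + i) (β + j) x := by
    intro x
    have h₁ := (beta_pos hα hβ).ne'
    have h₂ := (beta_pos (add_pos_of_pos_of_nonneg hα i.cast_nonneg)
      (add_pos_of_pos_of_nonneg hβ j.cast_nonneg)).ne'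
    by_cases hx : 0 < x ∧ x < 1
    · rw [betaPDFReal, betaPDFReal, if_pos hx, if_pos hx, add_sub_right_comm, add_sub_right_comm,
        Real.rpow_add_natCast hx.1.ne', Real.rpow_add_natCast (sub_pos.2 hx.2).ne']
      field_simp
    · simp [betaPDFReal, hx]
  simp_rw [key]
  rw [integral_const_mul, integral_betaPDFReal (by positivity) (by positivity), mul_one]

theorem beta_natCast_add_one (i j : ℕ) :
    beta ((i : ℝ) + 1) ((j : ℝ) + 1) = i.factorial * j.factorial / (i + j + 1).factorial := by
  rw [beta, show (i : ℝ) + 1 + (j + 1) = ((i + j + 1 : ℕ) : ℝ) + 1 by push_cast; ring]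
  simp_rw [Real.Gamma_nat_eq_factorial]

theorem ae_betaMeasure_mem_Ioo (α β : ℝ) : ∀ᵐ x ∂betaMeasure α β, x ∈ Ioo (0 : ℝ) 1 := by
  rw [betaMeasure, ae_withDensity_iff (by unfold betaPDF; fun_prop)]
  refine ae_of_all _ fun x hx => ?_
  contrapose! hx
  exact (betaPDF_eq α β x).trans (by rw [if_neg (by exact hx), ENNReal.ofReal_zero])

end BetaMoments

section PowerSemicircle

variable {lam a : ℝ}

/-- The real-valued density of `powerSemicircleOn lam a`. -/
noncomputable def powerSemicirclePDF (lam a x : ℝ) : ℝ :=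
  Set.indicator (Set.Ioo (-a) a)
      (fun x => (1 / (Real.sqrt Real.pi * a ^ (2 * lam))) *
        (Real.Gamma (lam + 1) / Real.Gamma (lam + 1 / 2)) *
        (a ^ 2 - x ^ 2) ^ (lam - 1 / 2)) x

theorem measurable_powerSemicirclePDF : Measurable (powerSemicirclePDF lam a) :=
  Measurable.indicator (by fun_prop) measurableSet_Ioo

theorem powerSemicircleConst_pos (ha : 0 < a) (hl : 0 ≤ lam) :
    0 < (1 / (Real.sqrt Real.pi * a ^ (2 * lam))) *
        (Real.Gamma (lam + 1) / Real.Gamma (lam + 1 / 2)) := by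
  have := Real.Gamma_pos_of_pos (show 0 < lam + 1 by positivity)
  have := Real.Gamma_pos_of_pos (show 0 < lam + 1 / 2 by positivity)
  positivity

theorem powerSemicirclePDF_nonneg (ha : 0 < a) (hl : 0 ≤ lam) (x : ℝ) :
    0 ≤ powerSemicirclePDF lam a x :=
  indicator_nonneg (fun x hx => mul_nonneg (powerSemicircleConst_pos ha hl).le
    (Real.rpow_nonneg (by nlinarith [hx.1, hx.2]) _)) x

theorem powerSemicirclePDF_comp_affine (ha : 0 < a) (hl : 0 ≤ lam) (t : ℝ) :
    powerSemicirclePDF lam a (2 * a * t - a)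
      = (2 * a)⁻¹ * betaPDFReal (lam + 1 / 2) (lam + 1 / 2) t := by
  have hmem : 2 * a * t - a ∈ Ioo (-a) a ↔ 0 < t ∧ t < 1 := by
    rw [mem_Ioo]
    constructor
    · rintro ⟨h₁, h₂⟩
      exact ⟨by by_contra! h; nlinarith, by by_contra! h; nlinarith⟩
    · rintro ⟨h₁, h₂⟩
      exact ⟨by nlinarith, by nlinarith⟩
  by_cases ht : 0 < t ∧ t < 1
  · rw [powerSemicirclePDF, indicator_of_mem (hmem.2 ht), betaPDFReal, if_pos ht, beta]
    have ht' : 0 < 1 - t := sub_pos.2 ht.2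
    have h₁ := Real.Gamma_pos_of_pos (show 0 < lam + 1 by positivity)
    have h₂ := Real.Gamma_pos_of_pos (show 0 < lam + 1 / 2 by positivity)
    have h₃ := Real.Gamma_pos_of_pos (show 0 < 2 * lam + 1 by positivity)
    have hdup := Real.Gamma_mul_Gamma_add_half (lam + 1 / 2)
    rw [show lam + 1 / 2 + 1 / 2 = lam + 1 by ring, show 2 * (lam + 1 / 2) = 2 * lam + 1 by ring,
      show 1 - (2 * lam + 1) = - (2 * lam) by ring, Real.rpow_neg two_pos.le] at hdup
    have h4 : ((2 * a) ^ 2) ^ (lam - 1 / 2) = 2 ^ (2 * lam) * a ^ (2 * lam) / (2 * a) := by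
      rw [← Real.mul_rpow two_pos.le ha.le, ← Real.rpow_natCast (2 * a) 2,
        ← Real.rpow_mul (by positivity), ← Real.rpow_sub_one (by positivity)]
      congr 1; push_cast; ring
    rw [show a ^ 2 - (2 * a * t - a) ^ 2 = (2 * a) ^ 2 * (t * (1 - t)) by ring,
      Real.mul_rpow (by positivity) (mul_pos ht.1 ht').le, Real.mul_rpow ht.1.le ht'.le, h4,
      show lam + 1 / 2 - 1 = lam - 1 / 2 by ring,
      show lam + 1 / 2 + (lam + 1 / 2) = 2 * lam + 1 by ring]
    have : Real.Gamma (lam + 1)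
        = Real.Gamma (2 * lam + 1) * (2 ^ (2 * lam))⁻¹ * √Real.pi / Real.Gamma (lam + 1 / 2) := by
      rw [← hdup]; field_simp
    rw [this]
    have := Real.rpow_pos_of_pos ha (2 * lam)
    have := Real.rpow_pos_of_pos two_pos (2 * lam)
    field_simp
  · rw [powerSemicirclePDF, indicator_of_notMem (by rwa [hmem]), betaPDFReal, if_neg ht, mul_zero]

theorem integrable_powerSemicirclePDF (ha : 0 < a) (hl : 0 ≤ lam) :
    Integrable (powerSemicirclePDF lam a) := by
  have h : Integrable fun t => powerSemicirclePDF lam a (2 * a * t - a) := by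
    simp_rw [powerSemicirclePDF_comp_affine ha hl]
    exact (integrable_betaPDFReal (by positivity) (by positivity)).const_mul _
  have h' := (integrable_comp_mul_left_iff (fun x => powerSemicirclePDF lam a (x - a))
    (show 2 * a ≠ 0 by positivity)).1 h
  simpa using h'.comp_add_right a

theorem integral_powerSemicirclePDF (ha : 0 < a) (hl : 0 ≤ lam) :
    ∫ x, powerSemicirclePDF lam a x = 1 := by
  have h := Measure.integral_comp_mul_left (fun x => powerSemicirclePDF lam a (x - a)) (2 * a)
  simp_rw [powerSemicirclePDF_comp_affine ha hl] at h
  rw [integral_const_mul, integral_betaPDFReal (by positivity) (by positivity),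
    integral_sub_right_eq_self, abs_of_pos (by positivity), smul_eq_mul] at h
  exact (mul_left_cancel₀ (by positivity) h).symm

theorem isProbabilityMeasure_powerSemicircleOn (ha : 0 < a) (hl : 0 ≤ lam) :
    IsProbabilityMeasure (powerSemicircleOn lam a) := by
  refine isProbabilityMeasure_iff.2 ?_
  rw [powerSemicircleOn, withDensity_apply _ .univ, Measure.restrict_univ]
  change ∫⁻ x, ENNReal.ofReal (powerSemicirclePDF lam a x) = 1
  rw [← ofReal_integral_eq_lintegral_ofReal (integrable_powerSemicirclePDF ha hl)
    (ae_of_all _ (powerSemicirclePDF_nonneg ha hl)), integral_powerSemicirclePDF ha hl,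
    ENNReal.ofReal_one]

theorem ae_powerSemicircleOn_mem_Icc : ∀ᵐ x ∂powerSemicircleOn lam a, x ∈ Icc (-a) a := by
  rw [powerSemicircleOn, ae_withDensity_iff]
  · refine ae_of_all _ fun x hx => ?_
    contrapose! hx
    rw [indicator_of_notMem (fun h => hx (Ioo_subset_Icc_self h)), ENNReal.ofReal_zero]
  · exact measurable_powerSemicirclePDF.ennreal_ofReal

theorem integral_powerSemicircleOn (ha : 0 < a) (hl : 0 ≤ lam) (f : ℝ → ℝ) :
    ∫ x, f x ∂powerSemicircleOn lam a = ∫ x, powerSemicirclePDF lam a x * f x := by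
  change ∫ x, f x ∂volume.withDensity (fun x => ENNReal.ofReal (powerSemicirclePDF lam a x)) = _
  rw [integral_withDensity_eq_integral_toReal_smul
    measurable_powerSemicirclePDF.ennreal_ofReal (by simp)]
  simp_rw [ENNReal.toReal_ofReal (powerSemicirclePDF_nonneg ha hl _), smul_eq_mul]

/-- Integration by parts against the power semicircle density. -/
theorem integral_powerSemicircleOn_ibp (ha : 0 < a) (hl : 0 ≤ lam) {f f' : ℝ → ℝ}
    (hf : ∀ x, HasDerivAt f (f' x) x) (hf' : Continuous f') :
    ∫ x, (f' x * (a ^ 2 - x ^ 2) - (2 * lam + 1) * x * f x) ∂powerSemicircleOn lam a = 0 := by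
  have := isProbabilityMeasure_powerSemicircleOn ha hl
  have hfc : Continuous f := continuous_iff_continuousAt.2 fun x => (hf x).continuousAt
  set C := (1 / (Real.sqrt Real.pi * a ^ (2 * lam))) *
        (Real.Gamma (lam + 1) / Real.Gamma (lam + 1 / 2)) with hC
  rw [integral_powerSemicircleOn ha hl]
  set g := fun x => f' x * (a ^ 2 - x ^ 2) - (2 * lam + 1) * x * f x with hg
  set F' : ℝ → ℝ := fun x => C * (a ^ 2 - x ^ 2) ^ (lam - 1 / 2) * g x with hF'
  have hind : (fun x => powerSemicirclePDF lam a x * g x) = indicator (Ioo (-a) a) F' := by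
    ext x
    by_cases hx : x ∈ Ioo (-a) a <;> simp [powerSemicirclePDF, hx, hF', hC]
  have hint : Integrable (indicator (Ioo (-a) a) F') := by
    rw [← hind]
    have h := integrable_of_ae_mem_Icc (μ := powerSemicircleOn lam a)
      ae_powerSemicircleOn_mem_Icc (f := g) (by fun_prop)
    change Integrable g (volume.withDensity
      (fun x => ENNReal.ofReal (powerSemicirclePDF lam a x))) at h
    rw [integrable_withDensity_iff measurable_powerSemicirclePDF.ennreal_ofReal (by simp)] at h
    simpa only [ENNReal.toReal_ofReal (powerSemicirclePDF_nonneg ha hl _), mul_comm] using h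
  rw [hind, integral_indicator measurableSet_Ioo, ← integral_Ioc_eq_integral_Ioo,
    ← intervalIntegral.integral_of_le (by linarith)]
  have hF : ∫ x in (-a)..a, F' x
      = (fun x => C * (f x * (a ^ 2 - x ^ 2) ^ (lam + 1 / 2))) a
        - (fun x => C * (f x * (a ^ 2 - x ^ 2) ^ (lam + 1 / 2))) (-a) := by
    refine intervalIntegral.integral_eq_sub_of_hasDerivAt_of_le
      (f := fun x => C * (f x * (a ^ 2 - x ^ 2) ^ (lam + 1 / 2))) (by linarith) ?_ ?_ ?_
    · refine Continuous.continuousOn (continuous_const.mul (hfc.mul ?_))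
      exact Continuous.rpow_const (by fun_prop) fun x => Or.inr (by positivity)
    · intro x hx
      have hpos : 0 < a ^ 2 - x ^ 2 := by nlinarith [hx.1, hx.2]
      have h₁ : HasDerivAt (fun x => a ^ 2 - x ^ 2) (-(2 * x)) x := by
        simpa using (hasDerivAt_pow 2 x).const_sub (a ^ 2)
      have h₂ := ((hf x).mul (h₁.rpow_const (p := lam + 1 / 2) (Or.inl hpos.ne'))).const_mul C
      have e : F' x = C * (f' x * (a ^ 2 - x ^ 2) ^ (lam + 1 / 2) + f x *
          (-(2 * x) * (lam + 1 / 2) * (a ^ 2 - x ^ 2) ^ (lam + 1 / 2 - 1))) := by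
        simp only [hF', hg]
        rw [show lam + 1 / 2 - 1 = lam - 1 / 2 by ring,
          show lam + 1 / 2 = lam - 1 / 2 + 1 by ring, Real.rpow_add_one hpos.ne']
        ring
      rw [e]
      exact h₂
    · rw [intervalIntegrable_iff_integrableOn_Ioo_of_le (by linarith)]
      exact (integrable_indicator_iff measurableSet_Ioo).1 hint
  rw [hF]
  simp [Real.zero_rpow (show lam + 2⁻¹ ≠ 0 by positivity)]

theorem integral_id_powerSemicircleOn (ha : 0 < a) (hl : 0 ≤ lam) :
    ∫ x, x ∂powerSemicircleOn lam a = 0 := by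
  have h := integral_powerSemicircleOn_ibp ha hl (f := fun _ => 1) (f' := fun _ => 0)
    (fun x => hasDerivAt_const x 1) continuous_const
  simp_rw [zero_mul, mul_one, zero_sub] at h
  rw [integral_neg, integral_const_mul, neg_eq_zero] at h
  exact (mul_eq_zero.1 h).resolve_left (by positivity)

theorem integral_pow_add_two_powerSemicircleOn (ha : 0 < a) (hl : 0 ≤ lam) (k : ℕ) :
    (k + 2 + 2 * lam) * ∫ x, x ^ (k + 2) ∂powerSemicircleOn lam a
      = a ^ 2 * (k + 1) * ∫ x, x ^ k ∂powerSemicircleOn lam a := by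
  have := isProbabilityMeasure_powerSemicircleOn ha hl
  have h := integral_powerSemicircleOn_ibp ha hl (f := fun x => x ^ (k + 1))
    (f' := fun x => (k + 1) * x ^ k) (fun x => by simpa using hasDerivAt_pow (k + 1) x)
    (by fun_prop)
  have e : ∀ x : ℝ, (k + 1) * x ^ k * (a ^ 2 - x ^ 2) - (2 * lam + 1) * x * x ^ (k + 1)
      = a ^ 2 * (k + 1) * x ^ k - (k + 2 + 2 * lam) * x ^ (k + 2) := fun x => by ring
  simp_rw [e] at h
  rw [integral_sub (integrable_of_ae_mem_Icc ae_powerSemicircleOn_mem_Icc (by fun_prop))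
    (integrable_of_ae_mem_Icc ae_powerSemicircleOn_mem_Icc (by fun_prop)),
    integral_const_mul, integral_const_mul] at h
  linarith

theorem arcsinMeasureOn_eq_powerSemicircleOn :
    arcsinMeasureOn a = powerSemicircleOn 0 a := by
  unfold arcsinMeasureOn powerSemicircleOn
  congr with x
  congr 1
  refine indicator_congr (fun x hx => ?_)|> fun h => congrFun h x
  have hpos : 0 < a ^ 2 - x ^ 2 := by nlinarith [hx.1, hx.2]
  rw [zero_sub, zero_add, zero_add, Real.Gamma_one, Real.Gamma_one_half_eq, mul_zero,
    Real.rpow_zero, Real.rpow_neg hpos.le, ← Real.sqrt_eq_rpow]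
  have := Real.mul_self_sqrt Real.pi_pos.le
  have := Real.sqrt_pos.2 hpos
  have := Real.pi_pos
  field_simp
  linarith

end PowerSemicircle

section Recurrence

open PowerSeries Finset

/-- The coefficients of `(1 - q X²)^(-c/2)` are characterized by this two-step recurrence. -/
def IsSqBinomialSeq (q c : ℝ) (A : ℕ → ℝ) : Prop :=
  A 0 = 1 ∧ A 1 = 0 ∧ ∀ k : ℕ, ((k : ℝ) + 2) * A (k + 2) = q * (k + c) * A k

variable {q c d : ℝ} {A B : ℕ → ℝ}

theorem IsSqBinomialSeq.unique (hA : IsSqBinomialSeq q c A) (hB : IsSqBinomialSeq q c B) :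
    A = B := by
  ext k
  induction k using Nat.twoStepInduction with
  | zero => rw [hA.1, hB.1]
  | one => rw [hA.2.1, hB.2.1]
  | more k h₀ _ =>
    have h : ((k : ℝ) + 2) * A (k + 2) = (k + 2) * B (k + 2) := by rw [hA.2.2, hB.2.2, h₀]
    exact mul_left_cancel₀ (by positivity) h

theorem isSqBinomialSeq_iff_derivative (F : ℝ⟦X⟧) :
    IsSqBinomialSeq q c (fun k => coeff k F) ↔
      constantCoeff F = 1 ∧
        derivative ℝ F = C q * (X * (X * derivative ℝ F)) + C (q * c) * (X * F) := by
  refine and_congr (by simp) ⟨fun h => ?_, fun h => ⟨?_, fun k => ?_⟩⟩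
  · ext k
    rw [map_add, coeff_C_mul, coeff_C_mul, coeff_derivative]
    rcases k with _ | _ | k
    · simpa using h.1
    · have := h.2 0
      simp only [coeff_succ_X_mul, coeff_zero_X_mul, Nat.cast_zero, Nat.cast_one, zero_add] at this ⊢
      linarith
    · have := h.2 (k + 1)
      simp only [coeff_succ_X_mul, coeff_derivative] at this ⊢
      push_cast at this ⊢
      linarith
  · simpa [coeff_derivative] using congrArg (coeff 0) h
  · have := congrArg (coeff (k + 1)) h
    rw [map_add, coeff_C_mul, coeff_C_mul, coeff_derivative] at this
    rcases k with _ | k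
    · simp only [coeff_succ_X_mul, coeff_zero_X_mul, Nat.cast_zero, zero_add] at this ⊢
      push_cast at this
      linarith
    · simp only [coeff_succ_X_mul, coeff_derivative] at this ⊢
      push_cast at this ⊢
      linarith

theorem IsSqBinomialSeq.convolution (hA : IsSqBinomialSeq q c A) (hB : IsSqBinomialSeq q d B) :
    IsSqBinomialSeq q (c + d) fun k => ∑ p ∈ antidiagonal k, A p.1 * B p.2 := by
  obtain ⟨hF₀, hF⟩ := (isSqBinomialSeq_iff_derivative (PowerSeries.mk A)).1 (by simpa using hA)
  obtain ⟨hG₀, hG⟩ := (isSqBinomialSeq_iff_derivative (PowerSeries.mk B)).1 (by simpa using hB)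
  have h := (isSqBinomialSeq_iff_derivative (q := q) (c := c + d)
    (PowerSeries.mk A * PowerSeries.mk B)).2 ⟨by rw [map_mul, hF₀, hG₀, one_mul], ?_⟩
  · simpa [coeff_mul] using h
  · rw [Derivation.leibniz, smul_eq_mul, smul_eq_mul, mul_add, map_mul, map_add]
    rw [map_mul] at hF hG
    linear_combination PowerSeries.mk A * hG + PowerSeries.mk B * hF

end Recurrence

section MomentIdentity

open Finset

variable {a : ℝ}

/-- The moments of `powerSemicircleOn (m / 2) a`, scaled by `(k + m).choose m`. -/
noncomputable def scaledMoment (a : ℝ) (m k : ℕ) : ℝ :=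
  (k + m).factorial / (k.factorial * m.factorial) * ∫ x, x ^ k ∂powerSemicircleOn (m / 2) a

theorem isSqBinomialSeq_scaledMoment (ha : 0 < a) (m : ℕ) :
    IsSqBinomialSeq (a ^ 2) (m + 1) (scaledMoment a m) := by
  have hm : (0 : ℝ) ≤ m / 2 := by positivity
  have := isProbabilityMeasure_powerSemicircleOn ha hm
  refine ⟨?_, ?_, fun k => ?_⟩
  · have := m.factorial_ne_zero
    simp [scaledMoment, this]
  · simp [scaledMoment, integral_id_powerSemicircleOn ha hm]
  · have h := integral_pow_add_two_powerSemicircleOn ha hm k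
    rw [scaledMoment, scaledMoment, show k + 2 + m = k + m + 1 + 1 by ring]
    have : ((k : ℝ) + 2 + m) * ∫ x, x ^ (k + 2) ∂powerSemicircleOn (m / 2) a
      = a ^ 2 * (k + 1) * ∫ x, x ^ k ∂powerSemicircleOn (m / 2) a := by
      rw [← h]; ring
    have := m.factorial_ne_zero
    have := k.factorial_ne_zero
    simp only [Nat.factorial_succ]
    push_cast
    field_simp
    linear_combination ((k : ℝ) + m + 1) * (k + 2) * ‹((k : ℝ) + 2 + m) * _ = _›

/-- The law of `W X + (1 - W) S` for independent `W ∼ Beta(1, m + 1)`, `X ∼ μ`, `S ∼ ν`. -/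
noncomputable def betaMixture (m : ℕ) (μ ν : Measure ℝ) : Measure ℝ :=
  ((betaMeasure 1 ((m : ℝ) + 1)).prod (μ.prod ν)).map
    fun q => q.1 * q.2.1 + (1 - q.1) * q.2.2

theorem isProbabilityMeasure_betaMeasure_one_nat (m : ℕ) :
    IsProbabilityMeasure (betaMeasure 1 ((m : ℝ) + 1)) :=
  isProbabilityMeasureBeta one_pos (by positivity)

theorem isProbabilityMeasure_betaMixture (m : ℕ) (μ ν : Measure ℝ) [IsProbabilityMeasure μ]
    [IsProbabilityMeasure ν] : IsProbabilityMeasure (betaMixture m μ ν) := by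
  have := isProbabilityMeasure_betaMeasure_one_nat m
  exact Measure.isProbabilityMeasure_map (by fun_prop)

theorem ae_betaMixture_mem_Icc (m : ℕ) {μ ν : Measure ℝ} [IsProbabilityMeasure μ]
    [IsProbabilityMeasure ν] {b c : ℝ} (hμ : ∀ᵐ x ∂μ, x ∈ Icc b c) (hν : ∀ᵐ x ∂ν, x ∈ Icc b c) :
    ∀ᵐ x ∂betaMixture m μ ν, x ∈ Icc b c := by
  have := isProbabilityMeasure_betaMeasure_one_nat m
  rw [betaMixture, ae_map_iff (p := fun x => x ∈ Set.Icc b c) (by fun_prop) measurableSet_Icc]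
  have h₁ := Measure.quasiMeasurePreserving_fst.ae
    (μa := (betaMeasure 1 ((m : ℝ) + 1)).prod (μ.prod ν)) (ae_betaMeasure_mem_Ioo 1 ((m : ℝ) + 1))
  have h₂ := (Measure.quasiMeasurePreserving_fst.comp Measure.quasiMeasurePreserving_snd).ae
    (μa := (betaMeasure 1 ((m : ℝ) + 1)).prod (μ.prod ν)) hμ
  have h₃ := (Measure.quasiMeasurePreserving_snd.comp Measure.quasiMeasurePreserving_snd).ae
    (μa := (betaMeasure 1 ((m : ℝ) + 1)).prod (μ.prod ν)) hν
  filter_upwards [h₁, h₂, h₃] with q hw hx hs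
  exact convex_Icc b c hx hs hw.1.le (sub_pos.2 hw.2).le (by ring)

theorem integral_pow_betaMixture (m k : ℕ) {μ ν : Measure ℝ} [IsProbabilityMeasure μ]
    [IsProbabilityMeasure ν] {b c : ℝ} (hμ : ∀ᵐ x ∂μ, x ∈ Icc b c) (hν : ∀ᵐ x ∂ν, x ∈ Icc b c) :
    ∫ x, x ^ k ∂betaMixture m μ ν = ∑ p ∈ antidiagonal k, k.choose p.1 *
      (beta (1 + p.1) (m + 1 + p.2) / beta 1 (m + 1) *
        ((∫ x, x ^ p.1 ∂μ) * ∫ x, x ^ p.2 ∂ν)) := by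
  have := isProbabilityMeasure_betaMeasure_one_nat m
  have hβ : ∀ᵐ x ∂betaMeasure 1 ((m : ℝ) + 1), x ∈ Icc (0 : ℝ) 1 :=
    (ae_betaMeasure_mem_Ioo _ _).mono fun x hx => Ioo_subset_Icc_self hx
  rw [betaMixture, integral_map (by fun_prop) (by fun_prop)]
  have e : ∀ q : ℝ × ℝ × ℝ, (q.1 * q.2.1 + (1 - q.1) * q.2.2) ^ k
      = ∑ p ∈ antidiagonal k, k.choose p.1 *
        ((q.1 ^ p.1 * (1 - q.1) ^ p.2) * (q.2.1 ^ p.1 * q.2.2 ^ p.2)) := by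
    intro q
    rw [(Commute.all _ _).add_pow']
    refine sum_congr rfl fun p _ => ?_
    rw [nsmul_eq_mul, mul_pow, mul_pow]
    ring
  simp_rw [e]
  rw [integral_finsetSum _ fun p _ => ?_]
  · refine sum_congr rfl fun p _ => ?_
    rw [integral_const_mul,
      integral_prod_mul (fun w : ℝ => w ^ p.1 * (1 - w) ^ p.2)
        (fun y : ℝ × ℝ => y.1 ^ p.1 * y.2 ^ p.2),
      integral_prod_mul (fun x : ℝ => x ^ p.1) (fun x : ℝ => x ^ p.2),
      integral_betaMeasure_pow_mul_pow one_pos (by positivity)]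
  · refine Integrable.const_mul (Integrable.mul_prod
      (f := fun w : ℝ => w ^ p.1 * (1 - w) ^ p.2)
      (g := fun y : ℝ × ℝ => y.1 ^ p.1 * y.2 ^ p.2)
      (integrable_of_ae_mem_Icc hβ (by fun_prop)) (Integrable.mul_prod
        (f := fun x : ℝ => x ^ p.1) (g := fun x : ℝ => x ^ p.2)
        (integrable_of_ae_mem_Icc hμ (by fun_prop)) (integrable_of_ae_mem_Icc hν (by fun_prop)))) _

theorem betaMixture_powerSemicircleOn (ha : 0 < a) (m : ℕ) :
    betaMixture m (powerSemicircleOn 0 a) (powerSemicircleOn (m / 2) a)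
      = powerSemicircleOn (((m + 1 : ℕ) : ℝ) / 2) a := by
  have := isProbabilityMeasure_powerSemicircleOn ha le_rfl
  have := isProbabilityMeasure_powerSemicircleOn ha (show (0 : ℝ) ≤ m / 2 by positivity)
  have := isProbabilityMeasure_powerSemicircleOn ha
    (show (0 : ℝ) ≤ ((m + 1 : ℕ) : ℝ) / 2 by positivity)
  have := isProbabilityMeasure_betaMixture m (powerSemicircleOn 0 a) (powerSemicircleOn (m / 2) a)
  refine measure_eq_of_moments (ae_betaMixture_mem_Icc m ae_powerSemicircleOn_mem_Icc
    ae_powerSemicircleOn_mem_Icc) ae_powerSemicircleOn_mem_Icc fun k => ?_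
  rw [integral_pow_betaMixture m k ae_powerSemicircleOn_mem_Icc ae_powerSemicircleOn_mem_Icc]
  have hconv := (isSqBinomialSeq_scaledMoment ha 0).convolution (isSqBinomialSeq_scaledMoment ha m)
  have hc : ((0 : ℕ) : ℝ) + 1 + (m + 1) = ((m + 1 : ℕ) : ℝ) + 1 := by push_cast; ring
  rw [hc] at hconv
  have h := congrFun (hconv.unique (isSqBinomialSeq_scaledMoment ha (m + 1))) k
  have hpos : (0 : ℝ) < (k + (m + 1)).factorial / (k.factorial * (m + 1).factorial) := by positivity
  refine mul_left_cancel₀ hpos.ne' (Eq.trans ?_ h)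
  rw [mul_sum]
  refine sum_congr rfl fun p hp => ?_
  obtain ⟨i, j⟩ := p
  obtain rfl : i + j = k := mem_antidiagonal.1 hp
  have hb₁ := beta_natCast_add_one i (m + j)
  have hb₂ := beta_natCast_add_one 0 m
  push_cast at hb₁ hb₂
  simp only [scaledMoment, Nat.cast_zero, zero_div, add_zero]
  rw [show (1 : ℝ) + i = i + 1 by ring, show (m : ℝ) + 1 + j = m + j + 1 by ring, hb₁,
    show beta 1 ((m : ℝ) + 1) = _ by simpa using hb₂, Nat.cast_add_choose,
    show i + (m + j) + 1 = i + j + (m + 1) by ring, show m + j = j + m by ring,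
    Nat.factorial_succ m]
  have h₁ := (i + j).factorial_ne_zero
  have h₂ := i.factorial_ne_zero
  have h₃ := j.factorial_ne_zero
  have h₄ := m.factorial_ne_zero
  have h₅ := (i + j + (m + 1)).factorial_ne_zero
  push_cast
  field_simp
  simp [Nat.factorial]

end MomentIdentity

section Dirichlet

open Fin

instance sFinite_dirichletOnes (m : ℕ) : SFinite (dirichletOnes m) := by
  unfold dirichletOnes; infer_instance

theorem lintegral_comp_smul_pos {m : ℕ} {r : ℝ} (hr : 0 < r) (f : (Fin m → ℝ) → ℝ≥0∞) :
    ∫⁻ p, f p = ENNReal.ofReal (r ^ m) * ∫⁻ p, f (r • p) := by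
  have h := lintegral_map_equiv f (Homeomorph.smulOfNeZero r hr.ne').toMeasurableEquiv
    (μ := (volume : Measure (Fin m → ℝ)))
  have e : ⇑(Homeomorph.smulOfNeZero r hr.ne').toMeasurableEquiv
      = fun p : Fin m → ℝ => r • p := rfl
  rw [e, Measure.map_addHaar_smul volume hr.ne', lintegral_smul_measure, smul_eq_mul] at h
  rw [← h, ← mul_assoc, ← ENNReal.ofReal_mul (by positivity), Module.finrank_fin_fun,
    abs_of_pos (by positivity), mul_inv_cancel₀ (by positivity), ENNReal.ofReal_one, one_mul]

theorem lintegral_pi_succ {m : ℕ} (μ : Measure ℝ) [SigmaFinite μ]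
    {f : (Fin (m + 1) → ℝ) → ℝ≥0∞} (hf : Measurable f) :
    ∫⁻ p, f p ∂Measure.pi (fun _ => μ)
      = ∫⁻ x, ∫⁻ p, f (cons x p) ∂Measure.pi (fun _ => μ) ∂μ := by
  have h := (measurePreserving_piFinSuccAbove (fun _ : Fin (m + 1) => μ) 0).symm
  rw [← h.lintegral_comp_emb (MeasurableEquiv.measurableEmbedding _), lintegral_prod]
  · simp [MeasurableEquiv.piFinSuccAbove_symm_apply, consEquiv]
  · exact (hf.comp (MeasurableEquiv.measurable _)).aemeasurable

theorem measurableSet_simplex (m : ℕ) :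
    MeasurableSet {p : Fin m → ℝ | (∀ j, 0 ≤ p j) ∧ ∑ j, p j ≤ 1} := by
  measurability

theorem lintegral_dirichletOnes (m : ℕ) (f : (Fin m → ℝ) → ℝ≥0∞) :
    ∫⁻ p, f p ∂dirichletOnes m = m.factorial *
      ∫⁻ p, {p : Fin m → ℝ | (∀ j, 0 ≤ p j) ∧ ∑ j, p j ≤ 1}.indicator f p := by
  rw [dirichletOnes, lintegral_smul_measure, smul_eq_mul,
    lintegral_indicator (measurableSet_simplex m)]

theorem cons_smul_mem_simplex_iff {m : ℕ} {w : ℝ} (hw : w ∈ Ioo (0 : ℝ) 1) (p : Fin m → ℝ) :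
    ((∀ j, 0 ≤ (cons w ((1 - w) • p) : Fin (m + 1) → ℝ) j)
        ∧ ∑ j, (cons w ((1 - w) • p) : Fin (m + 1) → ℝ) j ≤ 1)
      ↔ (∀ j, 0 ≤ p j) ∧ ∑ j, p j ≤ 1 := by
  have h : 0 < 1 - w := sub_pos.2 hw.2
  simp only [forall_fin_succ, sum_univ_succ, cons_zero, cons_succ, Pi.smul_apply, smul_eq_mul,
    ← Finset.mul_sum, mul_nonneg_iff_of_pos_left h, hw.1.le, true_and]
  refine and_congr_right fun _ => ?_
  rw [← le_sub_iff_add_le', mul_le_iff_le_one_right h]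

/-- Stick breaking for the flat Dirichlet distribution. -/
theorem lintegral_dirichletOnes_succ (m : ℕ) {f : (Fin (m + 1) → ℝ) → ℝ≥0∞} (hf : Measurable f) :
    ∫⁻ p, f p ∂dirichletOnes (m + 1)
      = ∫⁻ w, ∫⁻ p, f (cons w ((1 - w) • p)) ∂dirichletOnes m ∂betaMeasure 1 ((m : ℝ) + 1) := by
  have hcons : Measurable fun q : ℝ × (Fin m → ℝ) =>
      (cons q.1 ((1 - q.1) • q.2) : Fin (m + 1) → ℝ) := by
    refine measurable_pi_iff.2 fun j => ?_
    refine Fin.cases ?_ (fun j => ?_) j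
    · simpa using measurable_fst
    · simp only [cons_succ, Pi.smul_apply, smul_eq_mul]
      fun_prop
  have hfc : Measurable fun q : ℝ × (Fin m → ℝ) => f (cons q.1 ((1 - q.1) • q.2)) := hf.comp hcons
  rw [lintegral_dirichletOnes]
  have hind := hf.indicator (measurableSet_simplex (m + 1))
  rw [volume_pi, lintegral_pi_succ _ hind, ← lintegral_const_mul' _ _ (by simp), betaMeasure,
    lintegral_withDensity_eq_lintegral_mul _ (by unfold betaPDF; fun_prop)
      hfc.lintegral_prod_right']
  have hne : ∀ᵐ w : ℝ, w ≠ 0 ∧ w ≠ 1 :=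
    (Measure.ae_ne volume 0).and (Measure.ae_ne volume 1)
  refine lintegral_congr_ae (hne.mono fun w hw => ?_)
  by_cases h : w ∈ Ioo (0 : ℝ) 1
  · have h' : 0 < 1 - w := sub_pos.2 h.2
    have hbeta : 1 / beta 1 ((m : ℝ) + 1) = m + 1 := by
      have := beta_natCast_add_one 0 m
      push_cast at this
      rw [zero_add] at this
      rw [this, zero_add, Nat.factorial_succ]
      have := m.factorial_ne_zero
      push_cast
      field_simp
      simp
    rw [Pi.mul_apply, betaPDF_of_pos_lt_one h.1 h.2, hbeta, sub_self, Real.rpow_zero, mul_one,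
      add_sub_cancel_right, Real.rpow_natCast]
    rw [lintegral_dirichletOnes, ← volume_pi]
    dsimp only
    rw [lintegral_comp_smul_pos h' fun p =>
      {p : Fin (m + 1) → ℝ | (∀ j, 0 ≤ p j) ∧ ∑ j, p j ≤ 1}.indicator f (cons w p)]
    have e : ∀ p : Fin m → ℝ,
        {p : Fin (m + 1) → ℝ | (∀ j, 0 ≤ p j) ∧ ∑ j, p j ≤ 1}.indicator f (cons w ((1 - w) • p))
        = {p : Fin m → ℝ | (∀ j, 0 ≤ p j) ∧ ∑ j, p j ≤ 1}.indicator
          (fun p => f (cons w ((1 - w) • p))) p := by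
      intro p
      simp only [indicator, mem_ofPred_eq, cons_smul_mem_simplex_iff h]
    simp_rw [e]
    rw [ENNReal.ofReal_mul (by positivity), Nat.factorial_succ]
    have : ENNReal.ofReal ((m : ℝ) + 1) = (m + 1 : ℕ) := by
      rw [← ENNReal.ofReal_natCast]; push_cast; rfl
    rw [this]
    push_cast
    ring
  · have hb : betaPDF 1 ((m : ℝ) + 1) w = 0 :=
      (betaPDF_eq _ _ _).trans (by rw [if_neg (by exact h), ENNReal.ofReal_zero])
    rw [Pi.mul_apply, hb, zero_mul]
    have e : ∀ p : Fin m → ℝ,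
        {p : Fin (m + 1) → ℝ | (∀ j, 0 ≤ p j) ∧ ∑ j, p j ≤ 1}.indicator f (cons w p) = 0 := by
      intro p
      refine indicator_of_notMem (fun hp => h ?_) f
      simp only [mem_ofPred_eq, forall_fin_succ, sum_univ_succ, cons_zero, cons_succ] at hp
      have := Finset.sum_nonneg fun j (_ : j ∈ Finset.univ) => hp.1.2 j
      exact ⟨lt_of_le_of_ne hp.1.1 hw.1.symm, lt_of_le_of_ne (by linarith [hp.2]) hw.2⟩
    simp [e]

/-- The average of `x` with the first `m` weights `p` and the remaining weight on the last
coordinate. -/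
def weightedAverage (m : ℕ) (q : (Fin m → ℝ) × (Fin (m + 1) → ℝ)) : ℝ :=
  (∑ j, q.1 j * q.2 j.castSucc) + (1 - ∑ j, q.1 j) * q.2 (last m)

theorem measurable_weightedAverage (m : ℕ) : Measurable (weightedAverage m) := by
  unfold weightedAverage
  fun_prop

theorem weightedAverage_cons (m : ℕ) (w x : ℝ) (p : Fin m → ℝ) (y : Fin (m + 1) → ℝ) :
    weightedAverage (m + 1) (cons w ((1 - w) • p), cons x y)
      = w * x + (1 - w) * weightedAverage m (p, y) := by
  simp only [weightedAverage, sum_univ_succ, cons_zero, cons_succ, castSucc_zero, ← succ_castSucc,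
    ← succ_last, Pi.smul_apply, smul_eq_mul, mul_assoc, ← Finset.mul_sum]
  ring

/-- The law of the weighted average of `m + 1` independent samples of `μ`. -/
noncomputable def weightedAverageLaw (μ : Measure ℝ) (m : ℕ) : Measure ℝ :=
  ((dirichletOnes m).prod (Measure.pi fun _ : Fin (m + 1) => μ)).map (weightedAverage m)

theorem weightedAverageLaw_zero (μ : Measure ℝ) [IsProbabilityMeasure μ] :
    weightedAverageLaw μ 0 = μ := by
  have h : dirichletOnes 0 = Measure.dirac isEmptyElim := by
    have : {p : Fin 0 → ℝ | (∀ j, 0 ≤ p j) ∧ ∑ j, p j ≤ 1} = univ := by ext; simp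
    rw [dirichletOnes, this, Measure.restrict_univ, Nat.factorial_zero, Nat.cast_one, one_smul,
      volume_pi, Measure.pi_of_empty _ isEmptyElim]
  rw [weightedAverageLaw, h, Measure.dirac_prod, Measure.map_map (measurable_weightedAverage 0)
    (by fun_prop)]
  have e : weightedAverage 0 ∘ Prod.mk isEmptyElim = Function.eval (0 : Fin 1) := by
    ext y
    simp [weightedAverage]
  rw [e]
  exact (measurePreserving_eval (fun _ : Fin 1 => μ) 0).map_eq

theorem weightedAverageLaw_succ (μ : Measure ℝ) [IsProbabilityMeasure μ] (m : ℕ)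
    [SFinite (weightedAverageLaw μ m)] :
    weightedAverageLaw μ (m + 1) = betaMixture m μ (weightedAverageLaw μ m) := by
  refine Measure.ext_of_lintegral _ fun f hf => ?_
  have hT := measurable_weightedAverage
  have hfT : Measurable fun q => f (weightedAverage (m + 1) q) := hf.comp (hT (m + 1))
  rw [weightedAverageLaw, lintegral_map hf (hT _), lintegral_prod _ hfT.aemeasurable,
    lintegral_dirichletOnes_succ m hfT.lintegral_prod_right', betaMixture,
    lintegral_map hf (by fun_prop), lintegral_prod _ (by fun_prop)]
  refine lintegral_congr fun w => ?_
  rw [lintegral_prod _ (by fun_prop)]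
  have h₁ : ∀ p : Fin m → ℝ,
      ∫⁻ y, f (weightedAverage (m + 1) (cons w ((1 - w) • p), y)) ∂Measure.pi (fun _ => μ)
      = ∫⁻ x, ∫⁻ y, f (w * x + (1 - w) * weightedAverage m (p, y))
          ∂Measure.pi (fun _ => μ) ∂μ := by
    intro p
    have hg : Measurable fun y => f (weightedAverage (m + 1) (cons w ((1 - w) • p), y)) :=
      hfT.comp measurable_prodMk_left
    rw [lintegral_pi_succ μ hg]
    simp [weightedAverage_cons]
  have hmeas : Measurable fun z : ((Fin m → ℝ) × ℝ) × (Fin (m + 1) → ℝ) =>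
      f (w * z.1.2 + (1 - w) * weightedAverage m (z.1.1, z.2)) := by
    have := hT m
    fun_prop
  simp_rw [h₁]
  rw [lintegral_lintegral_swap hmeas.lintegral_prod_right'.aemeasurable]
  refine lintegral_congr fun x => ?_
  have := hT m
  rw [weightedAverageLaw, lintegral_map (by fun_prop) (hT m), lintegral_prod _ (by fun_prop)]

end Dirichlet

theorem weightedAverageLaw_powerSemicircleOn_zero {a : ℝ} (ha : 0 < a) (m : ℕ) :
    weightedAverageLaw (powerSemicircleOn 0 a) m = powerSemicircleOn (m / 2) a := by
  have := isProbabilityMeasure_powerSemicircleOn ha le_rfl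
  induction m with
  | zero => rw [weightedAverageLaw_zero, Nat.cast_zero, zero_div]
  | succ m ih =>
    have := isProbabilityMeasure_powerSemicircleOn ha (show (0 : ℝ) ≤ m / 2 by positivity)
    have : SFinite (weightedAverageLaw (powerSemicircleOn 0 a) m) := by rw [ih]; infer_instance
    rw [weightedAverageLaw_succ, ih, betaMixture_powerSemicircleOn ha]

/-- Remark 2.3: for any `a > 0` and `n ≥ 2`, the pushforward of the product of the
Dirichlet(1,...,1) measure on the `(n-1)`-dimensional simplex and the `n`-fold product
of the Arcsin distribution on `(-a, a)` under the randomly-weighted-average map is the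
power semicircle distribution on `(-a, a)` with `λ = (n-1)/2`. -/
theorem rwa_arcsin_eq_powerSemicircle_general (a : ℝ) (ha : 0 < a) (n : ℕ) (hn : 2 ≤ n) :
    Measure.map
      (fun q : (Fin (n - 1) → ℝ) × (Fin n → ℝ) =>
        (∑ j : Fin (n - 1), q.1 j * q.2 (Fin.castLE (Nat.sub_le n 1) j)) +
          (1 - ∑ j, q.1 j) * q.2 ⟨n - 1, by omega⟩)
      ((dirichletOnes (n - 1)).prod (Measure.pi fun _ : Fin n => arcsinMeasureOn a))
      = powerSemicircleOn (((n : ℝ) - 1) / 2) a := by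
  obtain ⟨m, rfl⟩ : ∃ m, n = m + 1 := ⟨n - 1, by omega⟩
  rw [arcsinMeasureOn_eq_powerSemicircleOn]
  have h := weightedAverageLaw_powerSemicircleOn_zero ha m
  rw [Nat.cast_add_one, add_sub_cancel_right]
  exact h
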